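/- Let Q_s ∈ ℂ[X] denote the shifted Lucas polynomials, Q_s(t) = L_s(2t − 2i), and let α_s = 2 if s = 0 and α_s = 1 if s ≥ 1. For all natural numbers s and h, the weighted inner product (1/4)·∫_0^π Q_s(i·(1 + cos φ))·conj(Q_h(i·(1 + cos φ))) dφ equals 0 if s ≠ h, and equals π·α_s/2 if s = h. In particular the shifted Lucas polynomials are orthogonal with respect to this inner product. -/

import Mathlib

open Polynomial Complex

/-- The Lucas polynomials: `L 0 = 2`, `L 1 = X`, `L (s+2) = X * L (s+1) + L s`. -/
noncomputable def lucas : ℕ → Polynomial ℝ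
  | 0 => 2
  | 1 => Polynomial.X
  | (s + 2) => Polynomial.X * lucas (s + 1) + lucas s

/-- The shifted Lucas polynomials `Q s (t) = L s (2t − 2i)`, over `ℂ`. -/
noncomputable def shiftedLucas (s : ℕ) : Polynomial ℂ :=
  ((lucas s).map (algebraMap ℝ ℂ)).comp (2 * Polynomial.X - Polynomial.C (2 * Complex.I))

/-- `α_s = 2` if `s = 0` and `α_s = 1` if `s ≥ 1`. -/
def lucasAlpha (s : ℕ) : ℝ := if s = 0 then 2 else 1

/-- On the imaginary segment `[-2i, 2i]`, Lucas polynomials are rotated cosines. -/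
theorem aeval_lucas_two_mul_I_mul_cos (s : ℕ) (z : ℂ) :
    aeval (2 * Complex.I * Complex.cos z) (lucas s) =
      2 * Complex.I ^ s * Complex.cos (s * z) := by
  induction s using Nat.twoStepInduction with
  | zero => simp [lucas, map_ofNat (aeval (2 * Complex.I * Complex.cos z)) 2]
  | one => simp [lucas]
  | more s ih₀ ih₁ =>
    rw [lucas, map_add, map_mul, aeval_X, ih₀, ih₁]
    have e₁ : ((s + 2 : ℕ) : ℂ) * z = ((s + 1 : ℕ) : ℂ) * z + z := by push_cast; ring
    have e₀ : (s : ℂ) * z = ((s + 1 : ℕ) : ℂ) * z - z := by push_cast; ring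
    rw [e₁, e₀, Complex.cos_add, Complex.cos_sub]
    linear_combination (2 * Complex.I ^ s * (Complex.cos (((s + 1 : ℕ) : ℂ) * z) * Complex.cos z +
      Complex.sin (((s + 1 : ℕ) : ℂ) * z) * Complex.sin z)) * Complex.I_sq

theorem eval_shiftedLucas_I_mul_one_add_cos (s : ℕ) (z : ℂ) :
    (shiftedLucas s).eval (Complex.I * (1 + Complex.cos z)) =
      2 * Complex.I ^ s * Complex.cos (s * z) := by
  rw [← aeval_lucas_two_mul_I_mul_cos, shiftedLucas, eval_comp, eval_map_algebraMap]
  congr 2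
  simp only [eval_sub, eval_mul, eval_ofNat, eval_X, eval_C]
  ring

theorem integral_zero_pi_cos_int_mul (n : ℤ) :
    ∫ φ in (0 : ℝ)..Real.pi, Complex.cos (n * (φ : ℂ)) = if n = 0 then (Real.pi : ℂ) else 0 := by
  split_ifs with hn
  · simp [hn]
  · rw [integral_cos_mul_complex (Int.cast_ne_zero.mpr hn), Complex.sin_int_mul_pi]
    simp

theorem integral_zero_pi_cos_nat_mul_mul_cos_nat_mul (s h : ℕ) :
    ∫ φ in (0 : ℝ)..Real.pi, Complex.cos (s * (φ : ℂ)) * Complex.cos (h * (φ : ℂ)) =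
      if s ≠ h then 0 else (Real.pi : ℂ) * (lucasAlpha s : ℂ) / 2 := by
  have product_to_sum (φ : ℝ) : Complex.cos (s * (φ : ℂ)) * Complex.cos (h * (φ : ℂ)) =
      (1 / 2 : ℂ) * (Complex.cos (((s + h : ℤ) : ℂ) * φ) +
        Complex.cos (((s - h : ℤ) : ℂ) * φ)) := by
    push_cast
    rw [add_mul, sub_mul, Complex.cos_add, Complex.cos_sub]
    ring
  have integrable (n : ℤ) : IntervalIntegrable (fun φ : ℝ => Complex.cos (n * (φ : ℂ)))
      MeasureTheory.volume 0 Real.pi :=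
    Continuous.intervalIntegrable (by fun_prop) _ _
  simp_rw [product_to_sum]
  rw [intervalIntegral.integral_const_mul,
    intervalIntegral.integral_add (integrable _) (integrable _),
    integral_zero_pi_cos_int_mul, integral_zero_pi_cos_int_mul]
  by_cases hsh : s = h
  · subst hsh
    by_cases hs : s = 0
    · simp [hs, lucasAlpha]
      ring
    · have : (s : ℤ) + s ≠ 0 := by omega
      simp [hs, this, lucasAlpha]
      ring
  · have hadd : (s : ℤ) + h ≠ 0 := by omega
    have hsub : (s : ℤ) - h ≠ 0 := by omega
    simp [hsh, hadd, hsub]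

/-- Orthogonality of the shifted Lucas polynomials: the weighted inner product
`(1/4)·∫_0^π Q_s(i(1+cos φ)) · conj (Q_h(i(1+cos φ))) dφ` equals `0` if `s ≠ h`,
and `π·α_s/2` if `s = h`. -/
theorem shiftedLucas_orthogonality (s h : ℕ) :
    (1 / 4 : ℂ) * ∫ φ in (0 : ℝ)..Real.pi,
        (shiftedLucas s).eval (Complex.I * (1 + Complex.cos (φ : ℂ))) *
          (starRingEnd ℂ) ((shiftedLucas h).eval (Complex.I * (1 + Complex.cos (φ : ℂ)))) =
      if s ≠ h then 0 else (Real.pi : ℂ) * (lucasAlpha s : ℂ) / 2 := by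
  have integrand (φ : ℝ) : (shiftedLucas s).eval (Complex.I * (1 + Complex.cos (φ : ℂ))) *
      (starRingEnd ℂ) ((shiftedLucas h).eval (Complex.I * (1 + Complex.cos (φ : ℂ)))) =
      (4 * Complex.I ^ s * (-Complex.I) ^ h) *
        (Complex.cos (s * (φ : ℂ)) * Complex.cos (h * (φ : ℂ))) := by
    simp only [eval_shiftedLucas_I_mul_one_add_cos, map_mul, map_pow, map_ofNat, Complex.conj_I,
      ← Complex.cos_conj, map_natCast, Complex.conj_ofReal]
    ring
  simp_rw [integrand]
  rw [intervalIntegral.integral_const_mul, integral_zero_pi_cos_nat_mul_mul_cos_nat_mul]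
  by_cases hsh : s = h
  · subst hsh
    have phase : Complex.I ^ s * (-Complex.I) ^ s = 1 := by
      rw [← mul_pow]
      simp
    simp only [ne_eq, not_true_eq_false, if_false]
    linear_combination ((Real.pi : ℂ) * (lucasAlpha s : ℂ) / 2) * phase
  · simp [hsh]
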